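/- Let $G$ be a Gröbner basis of an ideal $I \subseteq K[x, y]$ with respect to a block order $\prec$ eliminating the variables $x$ (where $x$, $y$ are disjoint finite variable sets). Then $G$, viewed as a subset of $K(y)[x]$, is a Gröbner basis of the extended ideal $I \cdot K(y)[x]$ with respect to the induced order on $x$-monomials. -/

import Mathlib

open MvPolynomial

/-- A monomial order on exponent vectors `σ →₀ ℕ`: a strict total order extending
(strict) divisibility of monomials and compatible with multiplication of monomials. -/
def IsMonomialOrder {σ : Type*} (prec : (σ →₀ ℕ) → (σ →₀ ℕ) → Prop) : Prop :=
  (∀ a b, a = b ∨ prec a b ∨ prec b a) ∧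
  (∀ a b c, prec a b → prec b c → prec a c) ∧
  (∀ a, ¬ prec a a) ∧
  (∀ a b : σ →₀ ℕ, a ≤ b → a ≠ b → prec a b) ∧
  (∀ a b c : σ →₀ ℕ, prec a b → prec (c + a) (c + b))

/-- `m` is the leading monomial of `f` with respect to the order `prec`. -/
def IsLeadingMonomial {σ R : Type*} [CommSemiring R] (prec : (σ →₀ ℕ) → (σ →₀ ℕ) → Prop)
    (f : MvPolynomial σ R) (m : σ →₀ ℕ) : Prop :=
  m ∈ f.support ∧ ∀ m' ∈ f.support, m' = m ∨ prec m' m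

/-- `G` is a (finite) Gröbner basis of the ideal `I` with respect to the order `prec`:
`G ⊆ I` and the leading monomial of every nonzero element of `I` is divisible by the
leading monomial of some element of `G` (divisibility of monomials being the pointwise
order on exponent vectors). -/
def IsGroebnerBasis {σ R : Type*} [CommSemiring R] (prec : (σ →₀ ℕ) → (σ →₀ ℕ) → Prop)
    (G : Set (MvPolynomial σ R)) (I : Ideal (MvPolynomial σ R)) : Prop :=
  G.Finite ∧ G ⊆ (I : Set (MvPolynomial σ R)) ∧
    ∀ f ∈ I, f ≠ 0 → ∀ m, IsLeadingMonomial prec f m →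
      ∃ g ∈ G, ∃ mg, IsLeadingMonomial prec g mg ∧ mg ≤ m

/-- The block order eliminating `x`, comparing `x`-parts first. -/
def blockOrder {σ τ : Type*} (prec1 : (σ →₀ ℕ) → (σ →₀ ℕ) → Prop)
    (prec2 : (τ →₀ ℕ) → (τ →₀ ℕ) → Prop) (a b : (σ ⊕ τ) →₀ ℕ) : Prop :=
  prec1 (Finsupp.sumFinsuppAddEquivProdFinsupp a).1 (Finsupp.sumFinsuppAddEquivProdFinsupp b).1 ∨
    ((Finsupp.sumFinsuppAddEquivProdFinsupp a).1 = (Finsupp.sumFinsuppAddEquivProdFinsupp b).1 ∧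
      prec2 (Finsupp.sumFinsuppAddEquivProdFinsupp a).2
        (Finsupp.sumFinsuppAddEquivProdFinsupp b).2)

/-- The canonical map `K[x,y] → K(y)[x]`, through which extension of ideals is taken. -/
noncomputable def toFracPoly (K σ τ : Type*) [Field K] :
    MvPolynomial (σ ⊕ τ) K →+* MvPolynomial σ (FractionRing (MvPolynomial τ K)) :=
  (MvPolynomial.map
      (algebraMap (MvPolynomial τ K) (FractionRing (MvPolynomial τ K)))).comp
    (sumAlgEquiv K σ τ).toRingEquiv.toRingHom

theorem exists_isLeadingMonomial {σ R : Type*} [CommSemiring R]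
    {prec : (σ →₀ ℕ) → (σ →₀ ℕ) → Prop} (h : IsMonomialOrder prec)
    {f : MvPolynomial σ R} (hf : f ≠ 0) : ∃ m, IsLeadingMonomial prec f m := by
  obtain ⟨htot, htrans, -, -, -⟩ := h
  suffices H : ∀ s : Finset (σ →₀ ℕ), s.Nonempty →
      ∃ m ∈ s, ∀ m' ∈ s, m' = m ∨ prec m' m from
    H f.support (by simpa [Finset.nonempty_iff_ne_empty] using hf)
  intro s hs
  induction hs using Finset.Nonempty.cons_induction with
  | singleton a => exact ⟨a, by simp⟩
  | cons a s _ _ ih =>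
    obtain ⟨m, hm, hmax⟩ := ih
    simp only [Finset.mem_cons, exists_eq_or_imp, forall_eq_or_imp]
    rcases htot a m with rfl | ham | hma
    · exact .inl ⟨.inl trivial, hmax⟩
    · exact .inr ⟨m, hm, .inr ham, hmax⟩
    · refine .inl ⟨.inl trivial, fun m' hm' ↦ .inr ?_⟩
      rcases hmax m' hm' with rfl | h
      · exact hma
      · exact htrans _ _ _ h hma

theorem coeff_coeff_sumAlgEquiv {R σ τ : Type*} [CommSemiring R]
    (f : MvPolynomial (σ ⊕ τ) R) (m : σ →₀ ℕ) (n : τ →₀ ℕ) :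
    ((sumAlgEquiv R σ τ f).coeff m).coeff n =
      f.coeff (Finsupp.sumFinsuppAddEquivProdFinsupp.symm (m, n)) := by
  simp [sumAlgEquiv, coeff, AddMonoidAlgebra.curryAlgEquiv, AddMonoidAlgebra.curryRingEquiv,
    AddMonoidAlgebra.curryAddEquiv]

theorem coeff_toFracPoly {K σ τ : Type*} [Field K] (f : MvPolynomial (σ ⊕ τ) K) (m : σ →₀ ℕ) :
    (toFracPoly K σ τ f).coeff m = algebraMap (MvPolynomial τ K) _
      ((sumAlgEquiv K σ τ f).coeff m) := by
  simp [toFracPoly, coeff_map]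

theorem mem_support_toFracPoly {K σ τ : Type*} [Field K] {f : MvPolynomial (σ ⊕ τ) K}
    {m : σ →₀ ℕ} : m ∈ (toFracPoly K σ τ f).support ↔ (sumAlgEquiv K σ τ f).coeff m ≠ 0 := by
  rw [mem_support_iff, coeff_toFracPoly, Ne, FaithfulSMul.algebraMap_eq_zero_iff]

theorem fst_mem_support_toFracPoly {K σ τ : Type*} [Field K] {f : MvPolynomial (σ ⊕ τ) K}
    {a : (σ ⊕ τ) →₀ ℕ} (ha : a ∈ f.support) :
    (Finsupp.sumFinsuppAddEquivProdFinsupp a).1 ∈ (toFracPoly K σ τ f).support := by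
  rw [mem_support_toFracPoly]
  intro h
  have := coeff_coeff_sumAlgEquiv f (Finsupp.sumFinsuppAddEquivProdFinsupp a).1
    (Finsupp.sumFinsuppAddEquivProdFinsupp a).2
  rw [h, Prod.mk.eta, AddEquiv.symm_apply_apply, coeff_zero] at this
  exact mem_support_iff.mp ha this.symm

theorem IsLeadingMonomial.toFracPoly {K σ τ : Type*} [Field K]
    {prec1 : (σ →₀ ℕ) → (σ →₀ ℕ) → Prop} {prec2 : (τ →₀ ℕ) → (τ →₀ ℕ) → Prop}
    {f : MvPolynomial (σ ⊕ τ) K} {a : (σ ⊕ τ) →₀ ℕ}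
    (h : IsLeadingMonomial (blockOrder prec1 prec2) f a) :
    IsLeadingMonomial prec1 (toFracPoly K σ τ f) (Finsupp.sumFinsuppAddEquivProdFinsupp a).1 := by
  refine ⟨fst_mem_support_toFracPoly h.1, fun m' hm' ↦ ?_⟩
  obtain ⟨n, hn⟩ := ne_zero_iff.mp (mem_support_toFracPoly.mp hm')
  rw [coeff_coeff_sumAlgEquiv] at hn
  rcases h.2 _ (mem_support_iff.mpr hn) with rfl | h | h
  · exact .inl (by rw [AddEquiv.apply_symm_apply])
  · exact .inr (by rwa [AddEquiv.apply_symm_apply] at h)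
  · exact .inl (by rw [← h.1, AddEquiv.apply_symm_apply])

theorem exists_isLeadingMonomial_blockOrder {K σ τ : Type*} [Field K]
    {prec1 : (σ →₀ ℕ) → (σ →₀ ℕ) → Prop} {prec2 : (τ →₀ ℕ) → (τ →₀ ℕ) → Prop}
    (h2 : IsMonomialOrder prec2) {f : MvPolynomial (σ ⊕ τ) K} {m : σ →₀ ℕ}
    (h : IsLeadingMonomial prec1 (toFracPoly K σ τ f) m) :
    ∃ a, (Finsupp.sumFinsuppAddEquivProdFinsupp a).1 = m ∧
      IsLeadingMonomial (blockOrder prec1 prec2) f a := by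
  obtain ⟨n, hn, hmax⟩ := exists_isLeadingMonomial h2 (mem_support_toFracPoly.mp h.1)
  rw [mem_support_iff, coeff_coeff_sumAlgEquiv] at hn
  refine ⟨Finsupp.sumFinsuppAddEquivProdFinsupp.symm (m, n), by rw [AddEquiv.apply_symm_apply],
    mem_support_iff.mpr hn, fun b hb ↦ ?_⟩
  rw [blockOrder, AddEquiv.apply_symm_apply]
  rcases h.2 _ (fst_mem_support_toFracPoly hb) with hbm | hbm
  · have hbn : (Finsupp.sumFinsuppAddEquivProdFinsupp b).2 ∈
        ((sumAlgEquiv K σ τ f).coeff m).support := by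
      rw [mem_support_iff, coeff_coeff_sumAlgEquiv, ← hbm, Prod.mk.eta, AddEquiv.symm_apply_apply]
      exact mem_support_iff.mp hb
    rcases hmax _ hbn with hbn | hbn
    · exact .inl ((AddEquiv.eq_symm_apply _).mpr (Prod.ext hbm hbn))
    · exact .inr (.inr ⟨hbm, hbn⟩)
  · exact .inr (.inl hbm)

attribute [local instance] algebraMvPolynomial in
theorem exists_C_mul_eq_toFracPoly {K σ τ : Type*} [Field K] {I : Ideal (MvPolynomial (σ ⊕ τ) K)}
    {f : MvPolynomial σ (FractionRing (MvPolynomial τ K))}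
    (hf : f ∈ Ideal.map (toFracPoly K σ τ) I) :
    ∃ c ≠ 0, ∃ h ∈ I, C c * f = toFracPoly K σ τ h := by
  rw [toFracPoly, ← Ideal.map_map] at hf
  obtain ⟨⟨⟨x, hx⟩, ⟨_, d, hd, rfl⟩⟩, hxd⟩ := (IsLocalization.mem_map_algebraMap_iff
    ((nonZeroDivisors (MvPolynomial τ K)).map (C (σ := σ)))
    (MvPolynomial σ (FractionRing (MvPolynomial τ K)))).mp hf
  obtain ⟨h, hI, rfl⟩ := (Ideal.mem_map_iff_of_surjective _
    (sumAlgEquiv K σ τ).surjective).mp hx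
  refine ⟨algebraMap _ _ d, ?_, h, hI, ?_⟩
  · simpa using nonZeroDivisors.ne_zero hd
  · rw [algebraMap_def, map_C, mul_comm] at hxd
    exact hxd

theorem IsLeadingMonomial.C_mul {σ F : Type*} [Field F] {prec : (σ →₀ ℕ) → (σ →₀ ℕ) → Prop}
    {f : MvPolynomial σ F} {m : σ →₀ ℕ} (h : IsLeadingMonomial prec f m) {c : F} (hc : c ≠ 0) :
    IsLeadingMonomial prec (C c * f) m := by
  have : (C c * f).support = f.support := by ext; simp [coeff_C_mul, hc]
  rwa [IsLeadingMonomial, this]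

/-- If `G` is a Gröbner basis of an ideal `I ⊆ K[x,y]` with respect to a
block order eliminating the variables `x`, then `G`, viewed in `K(y)[x]`, is a Gröbner
basis of the extended ideal `I·K(y)[x]` with respect to the induced order `≺₁` on
`x`-monomials. -/
theorem groebner_block_extends_to_fraction_field
    {K : Type*} [Field K] {σ τ : Type*} [Finite σ] [Finite τ]
    (prec1 : (σ →₀ ℕ) → (σ →₀ ℕ) → Prop) (prec2 : (τ →₀ ℕ) → (τ →₀ ℕ) → Prop)
    (h1 : IsMonomialOrder prec1) (h2 : IsMonomialOrder prec2)
    (I : Ideal (MvPolynomial (σ ⊕ τ) K)) (G : Set (MvPolynomial (σ ⊕ τ) K))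
    (hG : IsGroebnerBasis (blockOrder prec1 prec2) G I) :
    IsGroebnerBasis prec1 (toFracPoly K σ τ '' G) (Ideal.map (toFracPoly K σ τ) I) := by
  refine ⟨hG.1.image _, ?_, ?_⟩
  · rintro _ ⟨g, hg, rfl⟩
    exact Ideal.mem_map_of_mem _ (hG.2.1 hg)
  · intro f hf _ m hm
    obtain ⟨c, hc, h, hI, hch⟩ := exists_C_mul_eq_toFracPoly hf
    obtain ⟨a, rfl, ha⟩ := exists_isLeadingMonomial_blockOrder h2 (hch ▸ hm.C_mul hc)
    have h_ne : h ≠ 0 := support_nonempty.mp ⟨a, ha.1⟩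
    obtain ⟨g, hg, b, hb, hba⟩ := hG.2.2 h hI h_ne a ha
    exact ⟨_, ⟨g, hg, rfl⟩, _, hb.toFracPoly, fun i ↦ hba (Sum.inl i)⟩
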